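/- (Corollary 3.3, second identity.) For all integers N, M ≥ 0: B_i^{(N)} B_{τi}^{(M)} = ∑_{t=0}^{min(M,N)} B_{τi}^{(M−t)} ( ∏_{s=1}^{t} (q_i^{2t−N−M−s+1} k̃_{τi} − q_i^{−2t+N+M+s−1} k̃_i) / (q_i^{s} − q_i^{−s}) ) B_i^{(N−t)}. -/

import Mathlib

noncomputable section

/-- The quantum integer `[n]_v = (v^n - v^{-n})/(v - v^{-1})`. -/
def qint {K : Type*} [Field K] (v : RatFunc K) (n : ℤ) : RatFunc K :=
  (v ^ n - v ^ (-n)) / (v - v⁻¹)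

/-- The quantum factorial `[m]_v! = [1]_v [2]_v ⋯ [m]_v`. -/
def qfact {K : Type*} [Field K] (v : RatFunc K) (m : ℕ) : RatFunc K :=
  ∏ k ∈ Finset.range m, qint v ((k : ℤ) + 1)

/-- The divided power `x^{(m)} = x^m/[m]_v!` for `m ≥ 0`, and `0` for `m < 0`. -/
def dp {K : Type*} [Field K] {A : Type*} [Ring A] [Algebra (RatFunc K) A]
    (v : RatFunc K) (x : A) (m : ℤ) : A :=
  if m < 0 then 0 else (qfact v m.toNat)⁻¹ • x ^ m.toNat

/-- The element `v^a kt - v^{-a} ki`. -/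
def cartanFactor {K : Type*} [Field K] {A : Type*} [Ring A] [Algebra (RatFunc K) A]
    (v : RatFunc K) (ki kt : A) (a : ℤ) : A :=
  v ^ a • kt - v ^ (-a) • ki

/-- The Cartan binomial `∏_{s=0}^{t-1} (v^{c-s} kt - v^{-(c-s)} ki) / (v^{s+1} - v^{-(s+1)})`. -/
def cartanBinom {K : Type*} [Field K] {A : Type*} [Ring A] [Algebra (RatFunc K) A]
    (v : RatFunc K) (ki kt : A) (c : ℤ) (t : ℕ) : A :=
  ((List.range t).map fun s : ℕ =>
    (v ^ ((s : ℤ) + 1) - v ^ (-((s : ℤ) + 1)))⁻¹ • cartanFactor v ki kt (c - s)).prod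

section Helpers

variable {K : Type*} [Field K] {A : Type*} [Ring A] [Algebra (RatFunc K) A]
  {v : RatFunc K} {ki kt Bi Bt : A}

theorem RatFunc.X_pow_zpow_sub_zpow_neg_ne_zero {ε : ℕ} (hε : 0 < ε) (n : ℕ) :
    ((RatFunc.X : RatFunc K) ^ ε) ^ ((n : ℤ) + 1) - (RatFunc.X ^ ε) ^ (-((n : ℤ) + 1)) ≠ 0 := by
  intro h
  have hX : (RatFunc.X : RatFunc K) ^ ε ≠ 0 := pow_ne_zero _ RatFunc.X_ne_zero
  have h1 : ((RatFunc.X : RatFunc K) ^ ε) ^ (2 * (n + 1)) = 1 := by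
    calc ((RatFunc.X : RatFunc K) ^ ε) ^ (2 * (n + 1))
        = (RatFunc.X ^ ε) ^ ((n : ℤ) + 1) * (RatFunc.X ^ ε) ^ ((n : ℤ) + 1) := by
          rw [← zpow_add₀ hX, ← zpow_natCast]
          congr 1
          push_cast
          ring
      _ = (RatFunc.X ^ ε) ^ (-((n : ℤ) + 1)) * (RatFunc.X ^ ε) ^ ((n : ℤ) + 1) := by
          rw [sub_eq_zero.mp h]
      _ = 1 := by rw [← zpow_add₀ hX, neg_add_cancel, zpow_zero]
  rw [← pow_mul, ← RatFunc.algebraMap_X, ← map_pow,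
    ← map_one (algebraMap (Polynomial K) (RatFunc K))] at h1
  have h2 := congrArg Polynomial.natDegree (RatFunc.algebraMap_injective K h1)
  rw [Polynomial.natDegree_X_pow, Polynomial.natDegree_one] at h2
  have : 0 < ε * (2 * (n + 1)) := by positivity
  omega

theorem qint_zero : qint v 0 = 0 := by simp [qint]

theorem qint_ne_zero (hd : ∀ n : ℕ, v ^ ((n : ℤ) + 1) - v ^ (-((n : ℤ) + 1)) ≠ 0) (n : ℕ) :
    qint v ((n : ℤ) + 1) ≠ 0 := by
  have h := hd 0
  simp only [Nat.cast_zero, zero_add, zpow_one, zpow_neg] at h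
  exact div_ne_zero (hd n) h

theorem qint_one (hd : ∀ n : ℕ, v ^ ((n : ℤ) + 1) - v ^ (-((n : ℤ) + 1)) ≠ 0) :
    qint v 1 = 1 := by
  have h := hd 0
  simp only [Nat.cast_zero, zero_add, zpow_one, zpow_neg] at h
  simp [qint, div_self h]

theorem dp_of_neg (x : A) {m : ℤ} (hm : m < 0) : dp v x m = 0 := by simp [dp, hm]

theorem dp_zero (x : A) : dp v x 0 = 1 := by simp [dp, qfact]

theorem dp_natCast (x : A) (m : ℕ) : dp v x m = (qfact v m)⁻¹ • x ^ m := by simp [dp]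

/-- The recursion `x x^{(m)} = [m+1] x^{(m+1)}`, valid for every integer `m`. -/
theorem mul_dp (hd : ∀ n : ℕ, v ^ ((n : ℤ) + 1) - v ^ (-((n : ℤ) + 1)) ≠ 0) (x : A) (m : ℤ) :
    x * dp v x m = qint v (m + 1) • dp v x (m + 1) := by
  rcases lt_trichotomy m (-1) with h | rfl | h
  · rw [dp_of_neg x (by omega), dp_of_neg x (by omega), mul_zero, smul_zero]
  · rw [dp_of_neg x (by omega)]
    simp [qint_zero]
  · obtain ⟨n, rfl⟩ := Int.eq_ofNat_of_zero_le (show 0 ≤ m by omega)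
    have hn := qint_ne_zero hd n
    have h2 := dp_natCast (v := v) x (n + 1)
    push_cast at h2
    rw [dp_natCast, h2, mul_smul_comm, ← pow_succ', smul_smul, qfact, qfact,
      Finset.prod_range_succ, mul_inv, mul_left_comm, mul_inv_cancel₀ hn, mul_one]

theorem commute_cartanFactor (hkk : ki * kt = kt * ki) (a b : ℤ) :
    Commute (cartanFactor v ki kt a) (cartanFactor v ki kt b) := by
  have h : Commute ki kt := hkk
  unfold cartanFactor
  exact Commute.sub_left
    (Commute.sub_right (((Commute.refl kt).smul_left _).smul_right _)
      ((h.symm.smul_left _).smul_right _))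
    (Commute.sub_right ((h.smul_left _).smul_right _)
      (((Commute.refl ki).smul_left _).smul_right _))

theorem commute_cartanFactor_cartanBinom (hkk : ki * kt = kt * ki) (a c : ℤ) (t : ℕ) :
    Commute (cartanFactor v ki kt a) (cartanBinom v ki kt c t) := by
  refine Commute.list_prod_right _ _ fun x hx => ?_
  obtain ⟨s, -, rfl⟩ := List.mem_map.mp hx
  exact (commute_cartanFactor hkk a _).smul_right _

theorem mul_cartanFactor (hv : v ≠ 0) (h1 : ki * Bi = v ^ (-2 : ℤ) • (Bi * ki))
    (h3 : kt * Bi = v ^ (2 : ℤ) • (Bi * kt)) (a : ℤ) :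
    Bi * cartanFactor v ki kt a = cartanFactor v ki kt (a - 2) * Bi := by
  simp only [cartanFactor, mul_sub, sub_mul, mul_smul_comm, smul_mul_assoc, h1, h3, smul_smul,
    ← zpow_add₀ hv]
  congr 3 <;> ring

theorem mul_cartanBinom (hv : v ≠ 0) (h1 : ki * Bi = v ^ (-2 : ℤ) • (Bi * ki))
    (h3 : kt * Bi = v ^ (2 : ℤ) • (Bi * kt)) (c : ℤ) (t : ℕ) :
    Bi * cartanBinom v ki kt c t = cartanBinom v ki kt (c - 2) t * Bi := by
  unfold cartanBinom
  induction t with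
  | zero => simp
  | succ t ih =>
    simp only [List.range_succ, List.map_append, List.prod_append, List.map_singleton,
      List.prod_singleton]
    rw [← mul_assoc, ih, mul_assoc, mul_smul_comm, mul_cartanFactor hv h1 h3, mul_assoc,
      smul_mul_assoc, sub_right_comm]

theorem smul_cartanBinom_succ (hd : ∀ n : ℕ, v ^ ((n : ℤ) + 1) - v ^ (-((n : ℤ) + 1)) ≠ 0)
    (c : ℤ) (t : ℕ) :
    (v ^ ((t : ℤ) + 1) - v ^ (-((t : ℤ) + 1))) • cartanBinom v ki kt c (t + 1) =
      cartanBinom v ki kt c t * cartanFactor v ki kt (c - t) := by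
  simp only [cartanBinom, List.range_succ, List.map_append, List.prod_append, List.map_singleton,
    List.prod_singleton]
  rw [mul_smul_comm, smul_inv_smul₀ (hd t)]

theorem smul_cartanBinom_succ_left
    (hd : ∀ n : ℕ, v ^ ((n : ℤ) + 1) - v ^ (-((n : ℤ) + 1)) ≠ 0)
    (hkk : ki * kt = kt * ki) (c : ℤ) (t : ℕ) :
    (v ^ ((t : ℤ) + 1) - v ^ (-((t : ℤ) + 1))) • cartanBinom v ki kt (c + 1) (t + 1) =
      cartanBinom v ki kt c t * cartanFactor v ki kt (c + 1) := by
  induction t with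
  | zero =>
    rw [smul_cartanBinom_succ hd]
    simp [cartanBinom]
  | succ t ih =>
    rw [smul_cartanBinom_succ hd, ← smul_right_inj (hd t), ← smul_mul_assoc, ih,
      ← smul_mul_assoc, smul_cartanBinom_succ hd, mul_assoc, mul_assoc,
      (commute_cartanFactor hkk _ _).eq]
    push_cast
    ring_nf

theorem cartanFactor_mul (hv : v ≠ 0) (h2 : kt * Bt = v ^ (-2 : ℤ) • (Bt * kt))
    (h4 : ki * Bt = v ^ (2 : ℤ) • (Bt * ki)) (a : ℤ) :
    cartanFactor v ki kt a * Bt = Bt * cartanFactor v ki kt (a - 2) := by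
  simp only [cartanFactor, mul_sub, sub_mul, mul_smul_comm, smul_mul_assoc, h2, h4, smul_smul,
    ← zpow_add₀ hv]
  congr 3
  ring

theorem cartanFactor_mul_pow (hv : v ≠ 0) (h2 : kt * Bt = v ^ (-2 : ℤ) • (Bt * kt))
    (h4 : ki * Bt = v ^ (2 : ℤ) • (Bt * ki)) (a : ℤ) (n : ℕ) :
    cartanFactor v ki kt a * Bt ^ n = Bt ^ n * cartanFactor v ki kt (a - 2 * n) := by
  induction n with
  | zero => simp
  | succ n ih =>
    rw [pow_succ, ← mul_assoc, ih, mul_assoc, cartanFactor_mul hv h2 h4, mul_assoc]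
    push_cast
    ring_nf

theorem cartanFactor_mul_dp (hv : v ≠ 0) (h2 : kt * Bt = v ^ (-2 : ℤ) • (Bt * kt))
    (h4 : ki * Bt = v ^ (2 : ℤ) • (Bt * ki)) (a : ℤ) (n : ℕ) :
    cartanFactor v ki kt a * dp v Bt n = dp v Bt n * cartanFactor v ki kt (a - 2 * n) := by
  rw [dp_natCast, mul_smul_comm, smul_mul_assoc, cartanFactor_mul_pow hv h2 h4]

/-- The three-term relation `[m] ℓ(b - m - n) + [n] ℓ(b) = [m+n] ℓ(b - m)`, where
`ℓ = cartanFactor`. -/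
theorem qint_smul_cartanFactor_add (hv : v ≠ 0) (m n b : ℤ) :
    qint v m • cartanFactor v ki kt (b - m - n) + qint v n • cartanFactor v ki kt b =
      qint v (m + n) • cartanFactor v ki kt (b - m) := by
  have hkt : qint v m * v ^ (b - m - n) + qint v n * v ^ b = qint v (m + n) * v ^ (b - m) := by
    simp only [qint, div_mul_eq_mul_div, ← add_div, sub_mul, ← zpow_add₀ hv]
    ring_nf
  have hki : qint v m * v ^ (-(b - m - n)) + qint v n * v ^ (-b) =
      qint v (m + n) * v ^ (-(b - m)) := by
    simp only [qint, div_mul_eq_mul_div, ← add_div, sub_mul, ← zpow_add₀ hv]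
    ring_nf
  simp only [cartanFactor, smul_sub, smul_smul]
  rw [← hkt, ← hki, add_smul, add_smul]
  abel

/-- The exchange of one generator with a divided power of the other. -/
theorem mul_dp_exchange (hv : v ≠ 0)
    (hd : ∀ n : ℕ, v ^ ((n : ℤ) + 1) - v ^ (-((n : ℤ) + 1)) ≠ 0)
    (h2 : kt * Bt = v ^ (-2 : ℤ) • (Bt * kt)) (h4 : ki * Bt = v ^ (2 : ℤ) • (Bt * ki))
    (h5 : Bt * Bi - Bi * Bt = (v - v⁻¹)⁻¹ • (ki - kt)) (m : ℤ) :
    Bi * dp v Bt m = dp v Bt m * Bi +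
      (v - v⁻¹)⁻¹ • (dp v Bt (m - 1) * cartanFactor v ki kt (1 - m)) := by
  rcases lt_or_ge m 0 with hm | hm
  · simp [dp_of_neg Bt hm, dp_of_neg Bt (show m - 1 < 0 by omega)]
  obtain ⟨n, rfl⟩ := Int.eq_ofNat_of_zero_le hm
  induction n with
  | zero => simp [dp_zero, dp_of_neg]
  | succ n ih =>
    specialize ih (by omega)
    have hBB : Bi * Bt = Bt * Bi + (v - v⁻¹)⁻¹ • cartanFactor v ki kt 0 := by
      rw [← sub_eq_iff_eq_add', ← neg_sub, h5, ← smul_neg, neg_sub]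
      simp [cartanFactor]
    push_cast
    rw [← smul_right_inj (qint_ne_zero hd n), ← mul_smul_comm, smul_add, ← smul_mul_assoc,
      ← mul_dp hd, add_sub_cancel_right, ← mul_assoc,
hBB, add_mul, mul_assoc, ih, mul_add, mul_smul_comm, ← mul_assoc, ← mul_assoc, mul_dp hd,
      mul_dp hd, sub_add_cancel, smul_mul_assoc (qint v n), smul_mul_assoc (v - v⁻¹)⁻¹,
      cartanFactor_mul_dp hv h2 h4, add_assoc, ← smul_add, smul_comm (qint v ((n : ℤ) + 1)),
      ← mul_smul_comm, ← mul_smul_comm, ← mul_add]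
    have h := qint_smul_cartanFactor_add (ki := ki) (kt := kt) hv 1 n (1 - n)
    rw [qint_one hd, one_smul, add_comm, add_comm 1 (n : ℤ)] at h
    convert congrArg (fun x => qint v ((n : ℤ) + 1) • dp v Bt ((n : ℤ) + 1) * Bi +
      (v - v⁻¹)⁻¹ • (dp v Bt n * x)) h using 6 <;> ring_nf

/-- A Pascal-type recursion for the Cartan binomials. -/
theorem qint_smul_cartanBinom (hv : v ≠ 0)
    (hd : ∀ n : ℕ, v ^ ((n : ℤ) + 1) - v ^ (-((n : ℤ) + 1)) ≠ 0)
    (hkk : ki * kt = kt * ki) (p u : ℤ) (t : ℕ) :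
    qint v (p + (t + 1)) • cartanBinom v ki kt (u + 1) (t + 1) =
      qint v p • cartanBinom v ki kt u (t + 1) +
        (v - v⁻¹)⁻¹ • (cartanFactor v ki kt (u + 1 + p) * cartanBinom v ki kt u t) := by
  rw [← smul_right_inj (hd t), smul_add, smul_comm, smul_cartanBinom_succ_left hd hkk,
    smul_comm _ (qint v p), smul_cartanBinom_succ hd, smul_smul _ (v - v⁻¹)⁻¹, ← div_eq_mul_inv,
    ← qint, (commute_cartanFactor_cartanBinom hkk _ _ _).eq, ← mul_smul_comm, ← mul_smul_comm,
    ← mul_smul_comm, ← mul_add]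
  have h := qint_smul_cartanFactor_add (ki := ki) (kt := kt) hv p (t + 1) (u + 1 + p)
  rw [add_sub_cancel_right, add_sub_add_right_eq_sub] at h
  rw [h]

/-- The commutation formula for divided powers, summed over `0 ≤ t ≤ N`. -/
theorem dp_mul_dp (hv : v ≠ 0)
    (hd : ∀ n : ℕ, v ^ ((n : ℤ) + 1) - v ^ (-((n : ℤ) + 1)) ≠ 0)
    (hkk : ki * kt = kt * ki)
    (h1 : ki * Bi = v ^ (-2 : ℤ) • (Bi * ki)) (h2 : kt * Bt = v ^ (-2 : ℤ) • (Bt * kt))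
    (h3 : kt * Bi = v ^ (2 : ℤ) • (Bi * kt)) (h4 : ki * Bt = v ^ (2 : ℤ) • (Bt * ki))
    (h5 : Bt * Bi - Bi * Bt = (v - v⁻¹)⁻¹ • (ki - kt)) (N : ℕ) (M : ℤ) :
    dp v Bi N * dp v Bt M = ∑ t ∈ Finset.range (N + 1),
      dp v Bt (M - t) * cartanBinom v ki kt (2 * t - N - M) t * dp v Bi (N - t) := by
  induction N with
  | zero => simp [dp_zero, cartanBinom]
  | succ N ih =>
    let X : ℕ → A := fun t => qint v (N + 1 - t) •
      (dp v Bt (M - t) * cartanBinom v ki kt (2 * t - N - M - 2) t * dp v Bi (N + 1 - t))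
    let Y : ℕ → A := fun t => (v - v⁻¹)⁻¹ • (dp v Bt (M - t - 1) *
      (cartanFactor v ki kt (1 - (M - t)) * cartanBinom v ki kt (2 * t - N - M) t) *
      dp v Bi (N - t))
    have hXY (t : ℕ) : Bi * (dp v Bt (M - t) * cartanBinom v ki kt (2 * t - N - M) t *
        dp v Bi (N - t)) = X t + Y t := by
      have hB : Bi * dp v Bi ((N : ℤ) - t) =
          qint v (N + 1 - t) • dp v Bi ((N : ℤ) + 1 - t) := by
        rw [mul_dp hd, sub_add_eq_add_sub]
      simp only [X, Y]
      rw [mul_assoc, ← mul_assoc, mul_dp_exchange hv hd h2 h4 h5, add_mul]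
      congr 1
      · rw [mul_assoc, ← mul_assoc Bi, mul_cartanBinom hv h1 h3, mul_assoc _ Bi, hB,
          mul_smul_comm, mul_smul_comm, mul_assoc]
      · simp only [smul_mul_assoc, mul_assoc]
    have hXlast : X (N + 1) = 0 := by simp [X, qint_zero]
    rw [← smul_right_inj (qint_ne_zero hd N)]
    push_cast
    rw [← smul_mul_assoc, ← mul_dp hd, mul_assoc, ih, Finset.mul_sum,
      Finset.sum_congr rfl fun t _ => hXY t, Finset.sum_add_distrib,
      ← add_zero (∑ t ∈ Finset.range (N + 1), X t), ← hXlast, ← Finset.sum_range_succ,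
      Finset.sum_range_succ' X, Finset.sum_range_succ' _ (N + 1), add_right_comm,
      ← Finset.sum_add_distrib, smul_add, Finset.smul_sum]
    congr 1
    refine Finset.sum_congr rfl fun t _ => ?_
    have h := qint_smul_cartanBinom hv hd hkk ((N : ℤ) - t) (2 * t - N - M) t
    rw [show (N : ℤ) - t + (t + 1) = N + 1 by ring,
      show 2 * (t : ℤ) - N - M + 1 + (N - t) = 1 - (M - t) by ring] at h
    simp only [X, Y]
    push_cast
    rw [show 2 * ((t : ℤ) + 1) - (N + 1) - M = 2 * t - N - M + 1 by ring,
      show 2 * ((t : ℤ) + 1) - N - M - 2 = 2 * t - N - M by ring,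
      show (N : ℤ) + 1 - (t + 1) = N - t by ring, ← sub_sub M]
    simpa only [mul_add, add_mul, mul_smul_comm, smul_mul_assoc] using
      (congrArg (dp v Bt (M - t - 1) * · * dp v Bi ((N : ℤ) - t)) h).symm

end Helpers

/-- (Corollary 3.3, second identity.) For all N, M ≥ 0:
B_i^{(N)} B_{τi}^{(M)} = ∑_{t=0}^{min(M,N)} B_{τi}^{(M−t)}
  ( ∏_{s=1}^{t} (q_i^{2t−N−M−s+1} k̃_{τi} − q_i^{−2t+N+M+s−1} k̃_i) / (q_i^s − q_i^{−s}) )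
  B_i^{(N−t)}. -/
theorem stmt10 {K : Type*} [Field K] [CharZero K]
    {A : Type*} [Ring A] [Algebra (RatFunc K) A]
    (ε : ℕ) (hε : 0 < ε) (v : RatFunc K) (hv : v = RatFunc.X ^ ε)
    (Bi Bt ki kt : A)
    (hkk : ki * kt = kt * ki)
    (h1 : ki * Bi = v ^ (-2 : ℤ) • (Bi * ki))
    (h2 : kt * Bt = v ^ (-2 : ℤ) • (Bt * kt))
    (h3 : kt * Bi = v ^ (2 : ℤ) • (Bi * kt))
    (h4 : ki * Bt = v ^ (2 : ℤ) • (Bt * ki))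
    (h5 : Bt * Bi - Bi * Bt = (v - v⁻¹)⁻¹ • (ki - kt))
    (N M : ℕ) :
    dp v Bi (N : ℤ) * dp v Bt (M : ℤ)
      = ∑ t ∈ Finset.range (min M N + 1),
          dp v Bt ((M : ℤ) - (t : ℤ)) *
            ((List.range t).map fun s =>
              (v ^ ((s : ℤ) + 1) - v ^ (-((s : ℤ) + 1)))⁻¹ •
                (v ^ (2 * (t : ℤ) - (N : ℤ) - (M : ℤ) - (s : ℤ)) • kt
                  - v ^ (-(2 * (t : ℤ)) + (N : ℤ) + (M : ℤ) + (s : ℤ)) • ki)).prod *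
            dp v Bi ((N : ℤ) - (t : ℤ)) := by
  have hd := RatFunc.X_pow_zpow_sub_zpow_neg_ne_zero (K := K) hε
  have hv0 : v ≠ 0 := hv ▸ pow_ne_zero _ RatFunc.X_ne_zero
  rw [← hv] at hd
  rw [dp_mul_dp hv0 hd hkk h1 h2 h3 h4 h5]
  symm
  refine Finset.sum_subset_zero_on_sdiff
    (Finset.range_subset_range.mpr (by omega)) (fun t ht => ?_) (fun t _ => ?_)
  · simp only [Finset.mem_sdiff, Finset.mem_range] at ht
    rw [dp_of_neg Bt (by omega), zero_mul, zero_mul]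
  · simp only [cartanBinom, cartanFactor, bind_pure_comp, List.map_eq_map, List.map_map,
      Function.comp_def]
    congr 6
    ext s
    ring_nf
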